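/- The total number of edges of the base graph G satisfies |E(G)| ≤ c·opt·n + c·opt/p, where c = 2(e/(e−1) + 2) < 8. In particular, if opt < C'·log(1/ε)/ε² for a constant C' > 0 and some ε ∈ (0,1), then |E(G)| = O(n·log(1/ε)/ε² + log(1/ε)/(ε²·p)). -/

import Mathlib

open Finset

noncomputable section
open scoped Classical

variable {V : Type*} [Fintype V] [DecidableEq V]

/-- The probability that the realized graph `G* ~ G_p` (each edge of the base edge set `E`
kept independently with probability `p`) has edge set exactly `F`. -/
def edgeWeight (p : ℝ) (E F : Finset (Sym2 V)) : ℝ :=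
  p ^ F.card * (1 - p) ^ (E \ F).card

/-- The probability of an event `A` of the realized graph `G* ~ G_p`, where `E` is the
edge set of the base graph. -/
def probEvent (p : ℝ) (E : Finset (Sym2 V)) (A : Finset (Sym2 V) → Prop) : ℝ :=
  ∑ F ∈ E.powerset, if A F then edgeWeight p E F else 0

/-- The expectation of a real-valued function of the realized graph `G* ~ G_p`. -/
def expVal (p : ℝ) (E : Finset (Sym2 V)) (X : Finset (Sym2 V) → ℝ) : ℝ :=
  ∑ F ∈ E.powerset, edgeWeight p E F * X F

/-- `C` is a vertex cover of the graph with edge set `F`. -/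
def IsCoverOf (C : Finset V) (F : Finset (Sym2 V)) : Prop :=
  ∀ e ∈ F, ∃ v ∈ C, v ∈ e

/-- `MVC` assigns to every spanning subgraph of the base graph (given by its edge set
`F ⊆ E`) a vertex cover of minimum size. -/
def IsMinCoverFn (E : Finset (Sym2 V)) (MVC : Finset (Sym2 V) → Finset V) : Prop :=
  ∀ F ⊆ E, IsCoverOf (MVC F) F ∧ ∀ C : Finset V, IsCoverOf C F → (MVC F).card ≤ C.card

/-- `opt = E[|MVC(G*)|]`. -/
def optVal (p : ℝ) (E : Finset (Sym2 V)) (MVC : Finset (Sym2 V) → Finset V) : ℝ :=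
  expVal p E fun F => ((MVC F).card : ℝ)

/-- The number of edges of the induced subgraph `G[V \ S]` of the base graph. -/
def inducedEdgeCount (G : SimpleGraph V) [DecidableRel G.Adj] (S : Finset V) : ℕ :=
  (G.edgeFinset.filter fun e => ∀ v ∈ e, v ∉ S).card

theorem expVal_insert_aux (p : ℝ) (E : Finset (Sym2 V)) (e : Sym2 V) (he : e ∉ E)
    (X : Finset (Sym2 V) → ℝ) :
    expVal p (insert e E) X =
      (1 - p) * expVal p E X + p * expVal p E (fun F => X (insert e F)) := by
  unfold expVal
  rw [Finset.sum_powerset_insert he, Finset.mul_sum, Finset.mul_sum]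
  congr 1
  · apply Finset.sum_congr rfl
    intro F hF
    have hF' := Finset.mem_powerset.1 hF
    have heF : e ∉ F := fun h => he (hF' h)
    have h1 : insert e E \ F = insert e (E \ F) := Finset.insert_sdiff_of_notMem _ heF
    have h2 : e ∉ E \ F := fun h => he (Finset.mem_sdiff.1 h).1
    unfold edgeWeight
    rw [h1, Finset.card_insert_of_notMem h2, pow_succ]
    ring
  · apply Finset.sum_congr rfl
    intro F hF
    have hF' := Finset.mem_powerset.1 hF
    have heF : e ∉ F := fun h => he (hF' h)
    have h1 : insert e E \ insert e F = E \ F := by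
      ext x
      simp only [Finset.mem_sdiff, Finset.mem_insert]
      constructor
      · rintro ⟨h | h, h'⟩
        · exact absurd (Or.inl h) h'
        · exact ⟨h, fun h2 => h' (Or.inr h2)⟩
      · rintro ⟨h, h'⟩
        refine ⟨Or.inr h, ?_⟩
        rintro (h2 | h2)
        · exact he (h2 ▸ h)
        · exact h' h2
    unfold edgeWeight
    rw [h1, Finset.card_insert_of_notMem heF, pow_succ]
    ring

theorem edgeWeight_nonneg_aux (p : ℝ) (hp0 : 0 < p) (hp1 : p ≤ 1) (E F : Finset (Sym2 V)) :
    0 ≤ edgeWeight p E F :=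
  mul_nonneg (pow_nonneg hp0.le _) (pow_nonneg (by linarith) _)

theorem expVal_one_aux (p : ℝ) (E : Finset (Sym2 V)) : expVal p E (fun _ => 1) = 1 := by
  induction E using Finset.induction_on with
  | empty => simp [expVal, edgeWeight]
  | insert e E he ih => rw [expVal_insert_aux p E e he, ih]; ring

theorem expVal_sub_one_aux (p : ℝ) (E : Finset (Sym2 V)) (X : Finset (Sym2 V) → ℝ) :
    expVal p E (fun F => X F - 1) = expVal p E X - 1 := by
  have h := expVal_one_aux p E
  unfold expVal at *
  conv_rhs => rw [← h]
  rw [← Finset.sum_sub_distrib]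
  exact Finset.sum_congr rfl fun F _ => by ring

theorem touch_aux (E : Finset (Sym2 V)) (u : V) :
    (E.filter fun e => u ∈ e).card ≤ Fintype.card V := by
  have : (E.filter fun e => u ∈ e) ⊆ Finset.univ.image (fun w => s(u, w)) := by
    intro e h
    obtain ⟨w, hw⟩ := (Finset.mem_filter.1 h).2
    exact Finset.mem_image.2 ⟨w, Finset.mem_univ _, hw.symm⟩
  exact (Finset.card_le_card this).trans Finset.card_image_le

theorem main_aux (p : ℝ) (hp0 : 0 < p) (hp1 : p ≤ 1) (E : Finset (Sym2 V)) :
    ∀ (S : Finset V) (X : Finset (Sym2 V) → ℝ),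
      (∀ F ⊆ E, ∃ C : Finset V, (∀ e ∈ F, (∀ v ∈ e, v ∉ S) → ∃ v ∈ C, v ∈ e) ∧
        (C.card : ℝ) ≤ X F) →
      ((E.filter fun e => ∀ v ∈ e, v ∉ S).card : ℝ) ≤
        (1 / p + 2 * Fintype.card V) * expVal p E X := by
  have hK : 0 ≤ 1 / p + 2 * (Fintype.card V : ℝ) := by positivity
  induction E using Finset.induction_on with
  | empty =>
    intro S X hX
    obtain ⟨C, -, hC⟩ := hX ∅ (Finset.Subset.refl _)
    have h0 : (0 : ℝ) ≤ X ∅ := le_trans (Nat.cast_nonneg _) hC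
    simp only [Finset.filter_empty, Finset.card_empty, Nat.cast_zero]
    apply mul_nonneg hK
    simpa [expVal, edgeWeight] using h0
  | insert e E he ih =>
    intro S X hX
    rw [expVal_insert_aux p E e he]
    have h1 := ih S X (fun F hF => hX F (hF.trans (Finset.subset_insert _ _)))
    by_cases heS : ∀ v ∈ e, v ∉ S
    · rw [Finset.filter_insert, if_pos heS, Finset.card_insert_of_notMem (by simp [he])]
      obtain ⟨u, v, rfl⟩ : ∃ u v, e = s(u, v) := by
        induction e using Sym2.ind with
        | _ u v => exact ⟨u, v, rfl⟩
      have h2 := ih (insert u (insert v S)) (fun F => X (insert s(u, v) F) - 1) (by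
        intro F hF
        obtain ⟨C, hC, hc⟩ := hX _ (Finset.insert_subset_insert s(u, v) hF)
        obtain ⟨w, hwC, hw⟩ := hC _ (Finset.mem_insert_self _ _) heS
        refine ⟨C.erase w, ?_, ?_⟩
        · intro f hf hfS
          obtain ⟨x, hxC, hx⟩ := hC f (Finset.mem_insert_of_mem hf)
            (fun y hy hyS => hfS y hy (by simp [hyS]))
          refine ⟨x, Finset.mem_erase.2 ⟨?_, hxC⟩, hx⟩
          rintro rfl
          apply hfS x hx
          rcases Sym2.mem_iff.1 hw with h | h <;> simp [h]
        · have := Finset.card_erase_add_one hwC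
          have h3 : ((C.erase w).card : ℝ) + 1 = C.card := by exact_mod_cast this
          linarith)
      rw [expVal_sub_one_aux p E (fun F => X (insert s(u, v) F))] at h2
      have h3 : (E.filter fun e => ∀ v ∈ e, v ∉ S) ⊆
          (E.filter fun e => ∀ x ∈ e, x ∉ insert u (insert v S)) ∪
            ((E.filter fun e => u ∈ e) ∪ (E.filter fun e => v ∈ e)) := by
        intro f hf
        obtain ⟨hfE, hf⟩ := Finset.mem_filter.1 hf
        simp only [Finset.mem_union, Finset.mem_filter, Finset.mem_insert]
        by_cases hu : u ∈ f
        · exact Or.inr (Or.inl ⟨hfE, hu⟩)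
        by_cases hv : v ∈ f
        · exact Or.inr (Or.inr ⟨hfE, hv⟩)
        refine Or.inl ⟨hfE, fun x hx => ?_⟩
        rintro (rfl | rfl | h)
        · exact hu hx
        · exact hv hx
        · exact hf x hx h
      have h4 := (Finset.card_le_card h3).trans ((Finset.card_union_le _ _).trans
        (Nat.add_le_add_left ((Finset.card_union_le _ _).trans
          (Nat.add_le_add (touch_aux E u) (touch_aux E v))) _))
      have h5 := (Nat.cast_le (α := ℝ)).2 h4
      push_cast at h5 ⊢
      have h6 := mul_le_mul_of_nonneg_left h1 (sub_nonneg.2 hp1)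
      have h7 := mul_le_mul_of_nonneg_left (h5.trans (add_le_add_left h2 _)) hp0.le
      have h8 : p * (1 / p) = 1 := by field_simp
      linear_combination h6 + h7 - h8
    · rw [Finset.filter_insert, if_neg heS]
      have h2 := ih S (fun F => X (insert e F)) (by
        intro F hF
        obtain ⟨C, hC, hc⟩ := hX _ (Finset.insert_subset_insert e hF)
        exact ⟨C, fun f hf => hC f (Finset.mem_insert_of_mem hf), hc⟩)
      have h6 := mul_le_mul_of_nonneg_left h1 (sub_nonneg.2 hp1)
      have h7 := mul_le_mul_of_nonneg_left h2 hp0.le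
      linear_combination h6 + h7

/-- Lemma A.1. The total number of edges of the base graph satisfies
`|E(G)| ≤ c·opt·n + c·opt/p`, where `c = 2(e/(e−1) + 2) < 8`. In particular, if
`opt < C'·log(1/ε)/ε²` for a constant `C' > 0` and some `ε ∈ (0,1)`, then
`|E(G)| = O(n·log(1/ε)/ε² + log(1/ε)/(ε²·p))` (with constant `c·C'`). -/
theorem edge_count_bound
    (G : SimpleGraph V) [DecidableRel G.Adj]
    (p : ℝ) (hp0 : 0 < p) (hp1 : p ≤ 1)
    (MVC : Finset (Sym2 V) → Finset V)
    (hMVC : IsMinCoverFn G.edgeFinset MVC)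
    (opt : ℝ) (hopt : opt = optVal p G.edgeFinset MVC)
    (c : ℝ) (hc : c = 2 * (Real.exp 1 / (Real.exp 1 - 1) + 2)) :
    (G.edgeFinset.card : ℝ) ≤ c * opt * Fintype.card V + c * opt / p ∧
      ∀ C' ε : ℝ, 0 < C' → 0 < ε → ε < 1 →
        opt < C' * Real.log (1 / ε) / ε ^ 2 →
        (G.edgeFinset.card : ℝ) ≤
          c * C' * ((Fintype.card V : ℝ) * Real.log (1 / ε) / ε ^ 2 +
            Real.log (1 / ε) / (ε ^ 2 * p)) := by
  have h0 : 0 ≤ opt := by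
    rw [hopt]
    exact Finset.sum_nonneg fun F _ =>
      mul_nonneg (edgeWeight_nonneg_aux p hp0 hp1 _ _) (Nat.cast_nonneg _)
  have hm := main_aux p hp0 hp1 G.edgeFinset ∅ (fun F => ((MVC F).card : ℝ)) (fun F hF =>
    ⟨MVC F, fun e he _ => (hMVC F hF).1 e he, le_rfl⟩)
  have hm' : (G.edgeFinset.card : ℝ) ≤ (1 / p + 2 * Fintype.card V) * opt := by
    rw [hopt]
    simpa [optVal] using hm
  have hc4 : 4 ≤ c := by
    have : 1 < Real.exp 1 := by
      have := Real.add_one_lt_exp (one_ne_zero)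
      linarith
    have h : 0 ≤ Real.exp 1 / (Real.exp 1 - 1) :=
      div_nonneg (Real.exp_pos _).le (by linarith)
    rw [hc]; linarith
  have hn : (0 : ℝ) ≤ Fintype.card V := Nat.cast_nonneg _
  have hip : 0 < 1 / p := by positivity
  have key : (G.edgeFinset.card : ℝ) ≤ c * opt * Fintype.card V + c * opt / p := by
    have e1 : c * opt * Fintype.card V + c * opt / p =
      c * (opt * Fintype.card V) + c * (opt * (1 / p)) := by ring
    rw [e1]
    have a1 := mul_nonneg h0 hn
    have a2 := mul_nonneg h0 hip.le
    nlinarith [mul_nonneg (sub_nonneg.2 hc4) a1, mul_nonneg (sub_nonneg.2 hc4) a2]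
  refine ⟨key, fun C' ε _ _ _ hlt => key.trans ?_⟩
  have e2 : c * C' * ((Fintype.card V : ℝ) * Real.log (1 / ε) / ε ^ 2 +
      Real.log (1 / ε) / (ε ^ 2 * p)) =
      (C' * Real.log (1 / ε) / ε ^ 2) * (c * (Fintype.card V + 1 / p)) := by
    field_simp
  have e3 : c * opt * Fintype.card V + c * opt / p = opt * (c * (Fintype.card V + 1 / p)) := by
    ring
  rw [e2, e3]
  exact mul_le_mul_of_nonneg_right hlt.le (mul_nonneg (by linarith) (by linarith))
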